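/- For every real α with 1 < α < 2, the Beta function satisfies B(α/2, α/2) ≤ π/2^{α−1}, where B(x,y) = Γ(x)Γ(y)/Γ(x+y). -/

import Mathlib

open Real

/-- Log-convexity of `Γ` on `[1/2, s + 1/2]`, which contains both `s` and `1`. -/
theorem Gamma_le_sqrt_pi_mul_Gamma_add_half {s : ℝ} (hs : 1 / 2 ≤ s) :
    Real.Gamma s ≤ √π * Real.Gamma (s + 1 / 2) := by
  have hs0 : 0 < s := by linarith
  rcases hs.eq_or_lt with rfl | hlt
  · rw [Real.Gamma_one_half_eq]; norm_num
  set a : ℝ := 1 / (2 * s) with ha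
  set b : ℝ := (s - 1 / 2) / s with hb
  have ha0 : 0 < a := by positivity
  have hb0 : 0 < b := div_pos (by linarith) hs0
  have hab : a + b = 1 := by rw [ha, hb]; field_simp; ring
  have hA : 0 < Real.Gamma (1 / 2) := Real.Gamma_pos_of_pos (by norm_num)
  have hB : 0 < Real.Gamma (s + 1 / 2) := Real.Gamma_pos_of_pos (by linarith)
  have h₁ := Real.Gamma_mul_add_mul_le_rpow_Gamma_mul_rpow_Gamma
    (s := 1 / 2) (t := s + 1 / 2) (by norm_num) (by linarith) ha0 hb0 hab
  have h₂ := Real.Gamma_mul_add_mul_le_rpow_Gamma_mul_rpow_Gamma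
    (s := 1 / 2) (t := s + 1 / 2) (by norm_num) (by linarith) hb0 ha0 (by linarith)
  have e₁ : a * (1 / 2) + b * (s + 1 / 2) = s := by rw [ha, hb]; field_simp; ring
  have e₂ : b * (1 / 2) + a * (s + 1 / 2) = 1 := by rw [ha, hb]; field_simp; ring
  rw [e₁] at h₁
  rw [e₂, Real.Gamma_one] at h₂
  calc Real.Gamma s = Real.Gamma s * 1 := (mul_one _).symm
    _ ≤ (Real.Gamma (1 / 2) ^ a * Real.Gamma (s + 1 / 2) ^ b) *
        (Real.Gamma (1 / 2) ^ b * Real.Gamma (s + 1 / 2) ^ a) :=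
      mul_le_mul h₁ h₂ zero_le_one (by positivity)
    _ = Real.Gamma (1 / 2) ^ (a + b) * Real.Gamma (s + 1 / 2) ^ (a + b) := by
      rw [Real.rpow_add hA, Real.rpow_add hB]; ring
    _ = √π * Real.Gamma (s + 1 / 2) := by
      rw [hab, Real.rpow_one, Real.rpow_one, Real.Gamma_one_half_eq]

theorem beta_half_alpha_bound (α : ℝ) (hα1 : 1 < α) (hα2 : α < 2) :
    Real.Gamma (α / 2) * Real.Gamma (α / 2) / Real.Gamma (α / 2 + α / 2) ≤
      π / 2 ^ (α - 1) := by
  have hΓ : 0 < Real.Gamma (α / 2) := Real.Gamma_pos_of_pos (by linarith)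
  have hΓα : 0 < Real.Gamma α := Real.Gamma_pos_of_pos (by linarith)
  have hdup := Real.Gamma_mul_Gamma_add_half (α / 2)
  rw [mul_div_cancel₀ α two_ne_zero, ← neg_sub α 1, Real.rpow_neg two_pos.le] at hdup
  rw [add_halves, div_le_iff₀ hΓα]
  calc Real.Gamma (α / 2) * Real.Gamma (α / 2)
      ≤ Real.Gamma (α / 2) * (√π * Real.Gamma (α / 2 + 1 / 2)) :=
        mul_le_mul_of_nonneg_left
          (Gamma_le_sqrt_pi_mul_Gamma_add_half (by linarith)) hΓ.le
    _ = √π * (Real.Gamma (α / 2) * Real.Gamma (α / 2 + 1 / 2)) := by ring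
    _ = (√π * √π) / 2 ^ (α - 1) * Real.Gamma α := by rw [hdup]; ring
    _ = π / 2 ^ (α - 1) * Real.Gamma α := by rw [Real.mul_self_sqrt pi_pos.le]
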